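/- arXiv:2312.11429 — 2 statements merged into one kernel-verified Lean document; each statement's English description precedes it below -/
import Mathlib

section
/- Let y ∈ ℝ with |y| > λ/2 be fixed and let A ∈ ℝ^{1×N} be random with i.i.d. entries following the uniform distribution on (0,1). Then 2N · stsp(y,A) = 2N · [C_UL(y,A)]^{−1} converges in distribution, as N → ∞, to an exponential random variable with parameter 1; that is, for every t > 0, lim_{N→∞} ℙ(2N · stsp(y,A) < t) = 1 − e^{−t}. -/
open MeasureTheory ProbabilityTheory Filter Real Set
open scoped ENNReal NNReal

noncomputable section

/-- The LASSO objective function `‖Ax - y‖₂² + λ‖x‖₁`. -/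
def lassoObj {m N : ℕ} (lam : ℝ) (y : Fin m → ℝ) (A : Matrix (Fin m) (Fin N) ℝ)
    (x : Fin N → ℝ) : ℝ :=
  (∑ i, (A.mulVec x i - y i) ^ 2) + lam * ∑ j, |x j|

/-- The LASSO solution set `Sol(y,A)`. -/
def Sol {m N : ℕ} (lam : ℝ) (y : Fin m → ℝ) (A : Matrix (Fin m) (Fin N) ℝ) :
    Set (Fin N → ℝ) :=
  {x | ∀ z, lassoObj lam y A x ≤ lassoObj lam y A z}

/-- Support of a vector. -/
def supp {N : ℕ} (x : Fin N → ℝ) : Set (Fin N) := {i | x i ≠ 0}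

/-- Stability support: distance to support change. -/
def stsp {m N : ℕ} (lam : ℝ) (y : Fin m → ℝ) (A : Matrix (Fin m) (Fin N) ℝ) : ℝ :=
  sInf {δ : ℝ | 0 ≤ δ ∧ ∃ (y' : Fin m → ℝ) (A' : Matrix (Fin m) (Fin N) ℝ)
    (x x' : Fin N → ℝ), x ∈ Sol lam y A ∧ x' ∈ Sol lam y' A' ∧
    (∀ i, |y' i - y i| ≤ δ) ∧ (∀ i j, |A' i j - A i j| ≤ δ) ∧ supp x ≠ supp x'}

/-- The LASSO condition number `C_UL(y,A)`; it is `∞` when `stsp(y,A) = 0`. -/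
def condUL {m N : ℕ} (lam : ℝ) (y : Fin m → ℝ) (A : Matrix (Fin m) (Fin N) ℝ) : ℝ≥0∞ :=
  if stsp lam y A = 0 then ⊤ else ENNReal.ofReal (1 / stsp lam y A)

/-- `m = 1` case: identify `ℝ^{1×N}` with `ℝ^N` and `ℝ^1` with `ℝ`. -/
def Sol1 {N : ℕ} (lam : ℝ) (y : ℝ) (A : Fin N → ℝ) : Set (Fin N → ℝ) :=
  Sol lam (fun _ : Fin 1 => y) (Matrix.of fun _ j => A j)

def stsp1 {N : ℕ} (lam : ℝ) (y : ℝ) (A : Fin N → ℝ) : ℝ :=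
  stsp lam (fun _ : Fin 1 => y) (Matrix.of fun _ j => A j)

theorem mem_Sol1_iff {N : ℕ} {lam y : ℝ} {a x : Fin N → ℝ} :
    x ∈ Sol1 lam y a ↔ ∀ z : Fin N → ℝ,
      (a ⬝ᵥ x - y) ^ 2 + lam * ∑ j, |x j| ≤ (a ⬝ᵥ z - y) ^ 2 + lam * ∑ j, |z j| := by
  simp [Sol1, Sol, lassoObj, Matrix.mulVec, Matrix.of_apply]

theorem sum_abs_single {N : ℕ} (i : Fin N) (u : ℝ) :
    ∑ j, |(Pi.single i u : Fin N → ℝ) j| = |u| := by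
  rw [Finset.sum_eq_single i (fun j _ hj => by simp [hj]) (by simp)]
  simp

theorem supp_single {N : ℕ} (i : Fin N) {u : ℝ} (hu : u ≠ 0) :
    supp (Pi.single i u : Fin N → ℝ) = {i} := by
  ext j
  by_cases h : j = i
  · subst h; simp [supp, hu]
  · simp [supp, h]

/-- The best coefficient on a coordinate `i` whose column dominates. -/
theorem exists_coefficient {lam y b : ℝ} (hlam : 0 < lam) (h : lam / 2 < |b| * |y|) :
    ∃ u : ℝ, u ≠ 0 ∧
      (b * u - y) ^ 2 + lam * |u| = y ^ 2 - (|b| * |y| - lam / 2) ^ 2 / b ^ 2 := by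
  have hb : b ≠ 0 := by rintro rfl; simp at h; linarith
  have hby : b * y ≠ 0 := by
    intro h0
    rw [← abs_mul, h0] at h
    simp at h; linarith
  have hd : 0 < |b| * |y| - lam / 2 := by linarith
  rcases lt_or_gt_of_ne hby with hneg | hpos
  · have h1 : |b| * |y| = -(b * y) := by rw [← abs_mul, abs_of_neg hneg]
    rw [h1] at hd ⊢
    have hu : 0 < (-(b * y) - lam / 2) / b ^ 2 := div_pos hd (by positivity)
    refine ⟨-((-(b * y) - lam / 2) / b ^ 2), neg_ne_zero.2 hu.ne', ?_⟩
    rw [abs_neg, abs_of_pos hu]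
    field_simp
    ring
  · have h1 : |b| * |y| = b * y := by rw [← abs_mul, abs_of_pos hpos]
    rw [h1] at hd ⊢
    have hu : 0 < (b * y - lam / 2) / b ^ 2 := div_pos hd (by positivity)
    refine ⟨(b * y - lam / 2) / b ^ 2, hu.ne', ?_⟩
    rw [abs_of_pos hu]
    field_simp
    ring

/-- If the column `a i` dominates, then some solution is supported exactly on `{i}`. -/
theorem exists_mem_Sol1_supp_eq_singleton {N : ℕ} {lam y : ℝ} {a : Fin N → ℝ} (hlam : 0 < lam)
    (i : Fin N) (hi : ∀ j, |a j| ≤ |a i|) (h : lam / 2 < |a i| * |y|) :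
    ∃ x ∈ Sol1 lam y a, supp x = {i} := by
  obtain ⟨u, hu, hval⟩ := exists_coefficient hlam h
  refine ⟨Pi.single i u, mem_Sol1_iff.2 fun z => ?_, supp_single i hu⟩
  rw [sum_abs_single, dotProduct_single, hval]
  have hM : 0 < |a i| := by
    by_contra hM
    have : |a i| = 0 := le_antisymm (not_lt.1 hM) (abs_nonneg _)
    rw [this] at h; linarith
  have hw : |a ⬝ᵥ z| ≤ |a i| * ∑ j, |z j| := by
    rw [Finset.mul_sum]
    refine (Finset.abs_sum_le_sum_abs _ _).trans (Finset.sum_le_sum fun j _ => ?_)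
    rw [abs_mul]
    exact mul_le_mul_of_nonneg_right (hi j) (abs_nonneg _)
  have hw' : |a ⬝ᵥ z| / |a i| ≤ ∑ j, |z j| := (div_le_iff₀' hM).2 hw
  have hyw : a ⬝ᵥ z * y ≤ |a ⬝ᵥ z| * |y| := by rw [← abs_mul]; exact le_abs_self _
  have key : 0 ≤ (|a ⬝ᵥ z| - (|a i| * |y| - lam / 2) / |a i|) ^ 2 := sq_nonneg _
  have expand : (|a ⬝ᵥ z| - (|a i| * |y| - lam / 2) / |a i|) ^ 2 =
      (a ⬝ᵥ z) ^ 2 - 2 * (|a ⬝ᵥ z| * |y|) + lam * (|a ⬝ᵥ z| / |a i|)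
        + (|a i| * |y| - lam / 2) ^ 2 / a i ^ 2 := by
    rw [← sq_abs (a ⬝ᵥ z), ← sq_abs (a i)]
    field_simp
    ring
  nlinarith [mul_le_mul_of_nonneg_left hw' hlam.le]

/-- If the column `a i` strictly dominates, then every solution is supported exactly on `{i}`. -/
theorem supp_eq_singleton_of_mem_Sol1 {N : ℕ} {lam y : ℝ} {a x : Fin N → ℝ} (hlam : 0 < lam)
    (i : Fin N) (hi : ∀ j, j ≠ i → |a j| < |a i|) (h : lam / 2 < |a i| * |y|)
    (hx : x ∈ Sol1 lam y a) : supp x = {i} := by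
  rw [mem_Sol1_iff] at hx
  have ha : a i ≠ 0 := by intro h0; simp [h0] at h; linarith
  have hsub : ∀ j, j ≠ i → x j = 0 := by
    intro j hj
    by_contra hxj
    have hz := hx (x + Pi.single j (-x j) + Pi.single i (a j * x j / a i))
    have hdot : a ⬝ᵥ (x + Pi.single j (-x j) + Pi.single i (a j * x j / a i)) = a ⬝ᵥ x := by
      rw [dotProduct_add, dotProduct_add, dotProduct_single, dotProduct_single]
      field_simp
      ring
    have hlt : ∑ k, |(x + Pi.single j (-x j) + Pi.single i (a j * x j / a i) : Fin N → ℝ) k|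
        < ∑ k, |x k| := by
      have hle : ∀ k, |(x + Pi.single j (-x j) + Pi.single i (a j * x j / a i) : Fin N → ℝ) k| ≤
          |x k| + (Pi.single j (-|x j|) : Fin N → ℝ) k
            + |(Pi.single i (a j * x j / a i) : Fin N → ℝ) k| := by
        intro k
        refine (abs_add_le _ _).trans (add_le_add_left ?_ _)
        by_cases hk : k = j
        · subst hk; simp
        · simp [hk]
      refine (Finset.sum_le_sum fun k _ => hle k).trans_lt ?_
      rw [Finset.sum_add_distrib, Finset.sum_add_distrib, sum_abs_single,
        Finset.sum_pi_single']
      simp only [Finset.mem_univ, if_true]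
      have : |a j * x j / a i| < |x j| := by
        rw [abs_div, abs_mul, div_lt_iff₀ (abs_pos.2 ha), mul_comm]
        exact mul_lt_mul_of_pos_left (hi j hj) (abs_pos.2 hxj)
      linarith
    rw [hdot] at hz
    nlinarith
  have hxi : x i ≠ 0 := by
    intro hxi
    have hx0 : x = 0 := by
      ext j
      by_cases hj : j = i
      · rw [hj, hxi]; rfl
      · exact hsub j hj
    obtain ⟨u, -, hval⟩ := exists_coefficient hlam h
    have hz := hx (Pi.single i u)
    rw [sum_abs_single, dotProduct_single, hval, hx0] at hz
    have : 0 < (|a i| * |y| - lam / 2) ^ 2 / a i ^ 2 :=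
      div_pos (pow_pos (by linarith) 2) (by positivity)
    simp at hz
    linarith
  ext j
  simp only [supp, mem_ofPred_eq, mem_singleton_iff]
  exact ⟨fun hj => by_contra fun hji => hj (hsub j hji), fun hj => hj ▸ hxi⟩

/-- The set whose infimum is `stsp1`, in terms of vectors. -/
def supportChange {N : ℕ} (lam y : ℝ) (a : Fin N → ℝ) : Set ℝ :=
  {δ | 0 ≤ δ ∧ ∃ (y' : ℝ) (a' x x' : Fin N → ℝ), x ∈ Sol1 lam y a ∧ x' ∈ Sol1 lam y' a' ∧
    |y' - y| ≤ δ ∧ (∀ j, |a' j - a j| ≤ δ) ∧ supp x ≠ supp x'}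

theorem stsp1_eq_sInf {N : ℕ} (lam y : ℝ) (a : Fin N → ℝ) :
    stsp1 lam y a = sInf (supportChange lam y a) := by
  unfold stsp1 stsp supportChange
  congr 1
  ext δ
  refine and_congr_right fun _ => ⟨?_, ?_⟩
  · rintro ⟨y', A', x, x', hx, hx', hy, hA, hs⟩
    refine ⟨y' 0, A' 0, x, x', hx, ?_, hy 0, fun j => hA 0 j, hs⟩
    have h1 : (fun _ : Fin 1 => y' 0) = y' := by ext i; rw [Subsingleton.elim i 0]
    have h2 : (Matrix.of fun (_ : Fin 1) j => A' 0 j) = A' := by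
      ext i j; rw [Subsingleton.elim i 0]; rfl
    rw [Sol1, h1, h2]
    exact hx'
  · rintro ⟨y', a', x, x', hx, hx', hy, hA, hs⟩
    exact ⟨fun _ => y', Matrix.of fun _ j => a' j, x, x', hx, hx', fun _ => hy,
      fun _ j => hA j, hs⟩

/-- The largest entry of `a` exceeds all the other entries by at least `s`. -/
def HasGap {N : ℕ} (s : ℝ) (a : Fin N → ℝ) : Prop :=
  ∃ i, ∀ j, j ≠ i → a j ≤ a i - s

theorem stsp1_lt_of_not_hasGap {N : ℕ} {lam y s c : ℝ} {a : Fin N → ℝ} (hlam : 0 < lam)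
    (hpos : ∀ j, 0 < a j) (hc : ∃ j, c < a j) (hs : 0 < s) (hsc : s / 2 < c)
    (hcy : lam / 2 < (c - s / 2) * |y|) (hgap : ¬ HasGap s a) :
    stsp1 lam y a < s / 2 := by
  obtain ⟨k, hk⟩ := hc
  have : Nonempty (Fin N) := ⟨k⟩
  obtain ⟨i, hi⟩ := Finite.exists_max a
  have hci : c < a i := hk.trans_le (hi k)
  simp only [HasGap, not_exists, not_forall, not_le] at hgap
  obtain ⟨j, hji, hj⟩ := hgap i
  have hjle := hi j
  set m := (a i + a j) / 2 with hm
  have hmc : c - s / 2 < m := by rw [hm]; linarith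
  have hm0 : 0 < m := by linarith
  have hy0 : 0 ≤ |y| := abs_nonneg y
  obtain ⟨x, hx, hxs⟩ := exists_mem_Sol1_supp_eq_singleton (y := y) hlam i
    (fun l => by rw [abs_of_pos (hpos l), abs_of_pos (hpos i)]; exact hi l)
    (by rw [abs_of_pos (hpos i)]; nlinarith)
  let b : Fin N → ℝ := Function.update (fun l => min (a l) m) j m
  have hbj : b j = m := by simp [b]
  have hbl : ∀ l, l ≠ j → b l = min (a l) m := fun l hl => by simp [b, hl]
  obtain ⟨x', hx', hxs'⟩ := exists_mem_Sol1_supp_eq_singleton (a := b) (y := y) hlam j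
    (fun l => by
      by_cases hl : l = j
      · rw [hl]
      · rw [hbj, hbl l hl, abs_of_pos hm0, abs_of_pos (lt_min (hpos l) hm0)]
        exact min_le_right _ _)
    (by rw [hbj, abs_of_pos hm0]; nlinarith)
  have hmem : (a i - a j) / 2 ∈ supportChange lam y a := by
    refine ⟨by linarith, y, b, x, x', hx, hx', by simp; linarith, fun l => ?_, ?_⟩
    · by_cases hl : l = j
      · rw [hl, hbj, abs_le]; constructor <;> rw [hm] <;> linarith
      · rw [hbl l hl, abs_le]
        have := hi l
        constructor
        · have : a l - (a i - a j) / 2 ≤ min (a l) m :=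
            le_min (by linarith) (by rw [hm]; linarith)
          linarith
        · have := min_le_left (a l) m
          linarith
    · rw [hxs, hxs']
      exact fun h => hji (singleton_injective h).symm
  rw [stsp1_eq_sInf]
  exact (csInf_le ⟨0, fun δ hδ => hδ.1⟩ hmem).trans_lt (by linarith)

theorem le_stsp1_of_hasGap {N : ℕ} {lam y s c : ℝ} {a : Fin N → ℝ} (hlam : 0 < lam)
    (hpos : ∀ j, 0 < a j) (hc : ∃ j, c < a j) (hs : 0 < s) (hsc : s / 2 < c) (hsy : s / 2 < |y|)
    (hcy : lam / 2 < (c - s / 2) * (|y| - s / 2)) (hgap : HasGap s a) :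
    s / 2 ≤ stsp1 lam y a := by
  obtain ⟨i, hi⟩ := hgap
  have hmax : ∀ j, a j ≤ a i := fun j => by
    by_cases hj : j = i
    · rw [hj]
    · linarith [hi j hj]
  obtain ⟨k, hk⟩ := hc
  have hci : c < a i := hk.trans_le (hmax k)
  have hstable : ∀ δ, δ < s / 2 → ∀ (y' : ℝ) (a' x : Fin N → ℝ), x ∈ Sol1 lam y' a' →
      |y' - y| ≤ δ → (∀ j, |a' j - a j| ≤ δ) → supp x = {i} := by
    intro δ hδ y' a' x hx hy' ha'
    have hai := (abs_le.1 (ha' i)).1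
    have hai0 : c - s / 2 < a' i := by linarith
    have hyy : |y| - s / 2 < |y'| := by
      have := abs_sub_abs_le_abs_sub y y'
      rw [abs_sub_comm] at this
      linarith
    have habs : |a' i| = a' i := abs_of_pos (by linarith)
    refine supp_eq_singleton_of_mem_Sol1 hlam i (fun j hj => ?_) ?_ hx
    · have h1 := abs_le.1 (ha' j)
      have h2 := hi j hj
      have h3 := hpos j
      rw [habs, abs_lt]
      constructor <;> linarith
    · rw [habs]
      nlinarith
  obtain ⟨x, hx, hxs⟩ := exists_mem_Sol1_supp_eq_singleton (y := y) hlam i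
    (fun l => by rw [abs_of_pos (hpos l), abs_of_pos (hpos i)]; exact hmax l)
    (by rw [abs_of_pos (hpos i)]; nlinarith)
  rw [stsp1_eq_sInf]
  refine le_csInf ⟨a i, (hpos i).le, y, 0, x, 0, hx, ?_, by simpa using (hpos i).le,
    fun j => ?_, ?_⟩ ?_
  · rw [mem_Sol1_iff]
    intro z
    have : 0 ≤ lam * ∑ j, |z j| := by positivity
    simpa using this
  · simpa [abs_of_pos (hpos j)] using hmax j
  · rw [hxs]
    exact fun h => by simpa [supp] using h.subset (mem_singleton i)
  · rintro δ ⟨hδ0, y', a', w, x', hw, hx', hy', ha', hne⟩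
    by_contra! hlt
    refine hne ?_
    rw [hstable δ hlt y' a' x' hx' hy' ha']
    exact hstable δ hlt y a w hw (by simpa using hδ0) (fun j => by simpa using hδ0)

theorem volume_setOf_apply_eq {N : ℕ} {i j : Fin N} (hij : i ≠ j) :
    volume {v : Fin N → ℝ | v i = v j} = 0 := by
  let L : (Fin N → ℝ) →ₗ[ℝ] ℝ := LinearMap.proj (R := ℝ) (φ := fun _ => ℝ) i - LinearMap.proj j
  have h := Measure.addHaar_submodule (volume : Measure (Fin N → ℝ)) (LinearMap.ker L) (by
    intro htop
    have : (Pi.single i 1 : Fin N → ℝ) ∈ LinearMap.ker L := by rw [htop]; trivial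
    simp [L, hij] at this)
  convert h using 2
  ext v
  simp [L, sub_eq_zero]

theorem measurableSet_hasGap {N : ℕ} (s : ℝ) : MeasurableSet {v : Fin N → ℝ | HasGap s v} := by
  simp only [HasGap, ofPred_exists, ofPred_forall]
  exact MeasurableSet.iUnion fun i => MeasurableSet.iInter fun j => MeasurableSet.iInter fun _ =>
    measurableSet_le (measurable_pi_apply j) (Measurable.sub_const (measurable_pi_apply (X := fun _ => ℝ) i) s)

/-- Points of the unit cube whose largest entry exceeds the others by at least `s`. Translating the
largest coordinate by `s` rearranges this set into the cube of side `1 - s`. -/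
theorem volume_cube_inter_hasGap {N : ℕ} (hN : 2 ≤ N) {s : ℝ} (hs : 0 < s) :
    volume ({v : Fin N → ℝ | HasGap s v} ∩ Set.pi univ fun _ => Ioo 0 1)
      = ENNReal.ofReal (1 - s) ^ N := by
  have : Nontrivial (Fin N) := Fin.nontrivial_iff_two_le.2 hN
  let S : Fin N → Set (Fin N → ℝ) := fun i =>
    {v | ∀ j, j ≠ i → v j ≤ v i - s} ∩ Set.pi univ fun _ => Ioo 0 1
  let T : Fin N → Set (Fin N → ℝ) := fun i =>
    {w | ∀ j, w j ≤ w i} ∩ Set.pi univ fun _ => Ioo 0 (1 - s)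
  have hcube : ∀ r : ℝ, MeasurableSet (Set.pi univ fun _ : Fin N => Ioo 0 r) := fun r =>
    MeasurableSet.univ_pi fun _ => measurableSet_Ioo
  have hSm : ∀ i, MeasurableSet (S i) := fun i => by
    refine MeasurableSet.inter ?_ (hcube 1)
    simp only [ofPred_forall]
    exact MeasurableSet.iInter fun j => MeasurableSet.iInter fun _ =>
      measurableSet_le (measurable_pi_apply j) (Measurable.sub_const (measurable_pi_apply (X := fun _ => ℝ) i) s)
  have hTm : ∀ i, MeasurableSet (T i) := fun i => by
    refine MeasurableSet.inter ?_ (hcube (1 - s))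
    simp only [ofPred_forall]
    exact MeasurableSet.iInter fun j =>
      measurableSet_le (measurable_pi_apply j) (measurable_pi_apply i)
  have hST : ∀ i, volume (S i) = volume (T i) := by
    intro i
    rw [← measure_preimage_add_right volume (Pi.single i (-s)) (T i)]
    congr 1
    ext v
    simp only [S, T, mem_inter_iff, mem_ofPred_eq, mem_univ_pi, mem_preimage, Pi.add_apply,
      Pi.single_eq_same, mem_Ioo]
    obtain ⟨k, hk⟩ := exists_ne i
    constructor
    · rintro ⟨h1, h2⟩
      refine ⟨fun j => ?_, fun j => ?_⟩
      · by_cases hj : j = i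
        · simp [hj]
        · simp [hj]; linarith [h1 j hj]
      · by_cases hj : j = i
        · subst hj
          simp
          constructor <;> linarith [h1 k hk, h2 k, h2 j]
        · simp [hj]
          constructor <;> linarith [h1 j hj, h2 i, h2 j]
    · rintro ⟨h1, h2⟩
      have hi := h2 i
      simp at hi
      refine ⟨fun j hj => ?_, fun j => ?_⟩
      · have := h1 j
        simp [hj] at this
        linarith
      · by_cases hj : j = i
        · subst hj
          constructor <;> linarith
        · have := h2 j
          simp [hj] at this
          constructor <;> linarith
  have hSU : {v : Fin N → ℝ | HasGap s v} ∩ Set.pi univ (fun _ => Ioo 0 1) = ⋃ i, S i := by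
    rw [← iUnion_inter]
    congr 1
    ext v
    simp [HasGap]
  have hTU : (Set.pi univ fun _ : Fin N => Ioo 0 (1 - s)) = ⋃ i, T i := by
    rw [← iUnion_inter, eq_comm, inter_eq_right]
    intro w _
    obtain ⟨i, hi⟩ := Finite.exists_max w
    exact mem_iUnion.2 ⟨i, hi⟩
  have hSd : Pairwise (Function.onFun Disjoint S) := by
    intro i j hij
    refine Set.disjoint_left.2 fun v hv hv' => ?_
    have h1 := hv.1 j hij.symm
    have h2 := hv'.1 i hij
    linarith
  have hTd : Pairwise (Function.onFun (AEDisjoint volume) T) := by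
    intro i j hij
    refine measure_mono_null (fun w hw => ?_) (volume_setOf_apply_eq hij)
    exact le_antisymm (hw.2.1 i) (hw.1.1 j)
  rw [hSU, measure_iUnion hSd hSm]
  simp_rw [hST]
  rw [← measure_iUnion₀ hTd fun i => (hTm i).nullMeasurableSet, ← hTU, volume_pi_pi]
  simp

section Uniform

variable {Ω : Type*} [MeasurableSpace Ω] {μ : Measure Ω} {N : ℕ}
  {X : Ω → Fin N → ℝ}

theorem map_eq_restrict_cube [IsProbabilityMeasure μ] (hmeas : ∀ i, Measurable fun ω => X ω i)
    (hindep : iIndepFun (fun i ω => X ω i) μ)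
    (hlaw : ∀ i, Measure.map (fun ω => X ω i) μ = volume.restrict (Ioo (0 : ℝ) 1)) :
    Measure.map X μ = volume.restrict (Set.pi univ fun _ => Ioo 0 1) := by
  have h := (iIndepFun_iff_map_fun_eq_pi_map fun i => (hmeas i).aemeasurable).1 hindep
  simp_rw [hlaw] at h
  rw [volume_pi, Measure.restrict_pi_pi]
  exact h

theorem prob_hasGap (hX : Measurable X)
    (hmap : Measure.map X μ = volume.restrict (Set.pi univ fun _ => Ioo 0 1))
    (hN : 2 ≤ N) {s : ℝ} (hs : 0 < s) (hs1 : s ≤ 1) :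
    μ.real {ω | HasGap s (X ω)} = (1 - s) ^ N := by
  have h : μ {ω | HasGap s (X ω)} = Measure.map X μ {v | HasGap s v} :=
    (Measure.map_apply hX (measurableSet_hasGap s)).symm
  rw [measureReal_def, h, hmap, Measure.restrict_apply (measurableSet_hasGap s),
    volume_cube_inter_hasGap hN hs, ENNReal.toReal_pow, ENNReal.toReal_ofReal (by linarith)]

theorem prob_forall_le (hX : Measurable X)
    (hmap : Measure.map X μ = volume.restrict (Set.pi univ fun _ => Ioo 0 1))
    {c : ℝ} (hc : 0 ≤ c) :
    μ.real {ω | ¬ ((∀ j, 0 < X ω j) ∧ ∃ j, c < X ω j)} ≤ c ^ N := by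
  let B : Set (Fin N → ℝ) := {v | ¬ ((∀ j, 0 < v j) ∧ ∃ j, c < v j)}
  have hB : MeasurableSet B := by
    have h1 : MeasurableSet {v : Fin N → ℝ | ∀ j, 0 < v j} := by
      simp only [ofPred_forall]
      exact MeasurableSet.iInter fun j => measurableSet_lt measurable_const (measurable_pi_apply j)
    have h2 : MeasurableSet {v : Fin N → ℝ | ∃ j, c < v j} := by
      simp only [ofPred_exists]
      exact MeasurableSet.iUnion fun j => measurableSet_lt measurable_const (measurable_pi_apply j)
    exact (h1.inter h2).compl
  have h : μ {ω | ¬ ((∀ j, 0 < X ω j) ∧ ∃ j, c < X ω j)} = Measure.map X μ B :=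
    (Measure.map_apply hX hB).symm
  have hle : Measure.map X μ B ≤ ENNReal.ofReal c ^ N := by
    rw [hmap, Measure.restrict_apply hB]
    calc volume (B ∩ Set.pi univ fun _ => Ioo 0 1)
        ≤ volume (Set.pi univ fun _ : Fin N => Ioc 0 c) := by
          refine measure_mono fun v hv => ?_
          rw [mem_univ_pi]
          intro j
          refine ⟨(hv.2 j trivial).1, ?_⟩
          by_contra! hlt
          exact hv.1 ⟨fun k => (hv.2 k trivial).1, j, hlt⟩
      _ = ENNReal.ofReal c ^ N := by rw [volume_pi_pi]; simp
  rw [measureReal_def, h]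
  refine (ENNReal.toReal_mono (by simp) hle).trans ?_
  rw [ENNReal.toReal_pow, ENNReal.toReal_ofReal hc]

/-- Non-asymptotic form: up to `c ^ N`, the law of `stsp1` is the law of half the gap. -/
theorem abs_prob_stsp1_lt_sub_le [IsProbabilityMeasure μ] (hX : Measurable X)
    (hmap : Measure.map X μ = volume.restrict (Set.pi univ fun _ => Ioo 0 1))
    (hN : 2 ≤ N) {lam y s c : ℝ} (hlam : 0 < lam) (hs : 0 < s) (hs1 : s ≤ 1)
    (hsc : s / 2 < c) (hsy : s / 2 < |y|) (hcy : lam / 2 < (c - s / 2) * (|y| - s / 2)) :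
    |μ.real {ω | stsp1 lam y (X ω) < s / 2} - (1 - (1 - s) ^ N)| ≤ c ^ N := by
  have hcy' : lam / 2 < (c - s / 2) * |y| := by nlinarith
  have hbad := prob_forall_le hX hmap (μ := μ) (c := c) (by linarith)
  have hgap : μ.real {ω | ¬ HasGap s (X ω)} = 1 - (1 - s) ^ N := by
    rw [← prob_hasGap hX hmap hN hs hs1]
    exact probReal_compl_eq_one_sub (hX (measurableSet_hasGap s))
  rw [← hgap, abs_sub_le_iff]
  constructor
  · have : μ.real {ω | stsp1 lam y (X ω) < s / 2} ≤ μ.real ({ω | ¬ HasGap s (X ω)} ∪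
        {ω | ¬ ((∀ j, 0 < X ω j) ∧ ∃ j, c < X ω j)}) := by
      refine measureReal_mono fun ω hω => ?_
      by_contra hcon
      simp only [mem_union, mem_ofPred_eq, not_or, not_not] at hcon
      exact absurd hω (not_lt.2
        (le_stsp1_of_hasGap hlam hcon.2.1 hcon.2.2 hs hsc hsy hcy hcon.1))
    linarith [measureReal_union_le (μ := μ) {ω | ¬ HasGap s (X ω)}
      {ω | ¬ ((∀ j, 0 < X ω j) ∧ ∃ j, c < X ω j)}]
  · have : μ.real {ω | ¬ HasGap s (X ω)} ≤ μ.real ({ω | stsp1 lam y (X ω) < s / 2} ∪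
        {ω | ¬ ((∀ j, 0 < X ω j) ∧ ∃ j, c < X ω j)}) := by
      refine measureReal_mono fun ω hω => ?_
      by_contra hcon
      simp only [mem_union, mem_ofPred_eq, not_or, not_not] at hcon
      exact hcon.1 (stsp1_lt_of_not_hasGap hlam hcon.2.1 hcon.2.2 hs hsc hcy' hω)
    linarith [measureReal_union_le (μ := μ) {ω | stsp1 lam y (X ω) < s / 2}
      {ω | ¬ ((∀ j, 0 < X ω j) ∧ ∃ j, c < X ω j)}]

end Uniform

/-- For fixed `y` with `|y| > λ/2` and `A ∈ ℝ^{1×N}` with i.i.d. entries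
uniform on `(0,1)`, `2N · stsp(y,A)` converges in distribution to an exponential random
variable with parameter `1`: for every `t > 0`,
`lim_{N→∞} ℙ(2N · stsp(y,A) < t) = 1 − e^{−t}`. -/
theorem uniform_condition_limit
    (lam : ℝ) (hlam : 0 < lam) (y : ℝ) (hy : lam / 2 < |y|)
    (Ω : Type) [MeasurableSpace Ω] (μ : Measure Ω) [IsProbabilityMeasure μ]
    (A : (N : ℕ) → Ω → Fin N → ℝ)
    (hmeas : ∀ N i, Measurable fun ω => A N ω i)
    (hindep : ∀ N, iIndepFun (fun i ω => A N ω i) μ)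
    (hlaw : ∀ N i, Measure.map (fun ω => A N ω i) μ = volume.restrict (Set.Ioo (0:ℝ) 1))
    (t : ℝ) (ht : 0 < t) :
    Tendsto
      (fun N : ℕ => (μ {ω | 2 * (N : ℝ) * stsp1 lam y (A N ω) < t}).toReal)
      atTop (nhds (1 - Real.exp (-t))) := by
  have hy0 : 0 < |y| := by linarith
  obtain ⟨c, hc, hc1⟩ : ∃ c, lam / 2 / |y| < c ∧ c < 1 :=
    exists_between ((div_lt_one hy0).2 hy)
  have hc0 : 0 < c := lt_trans (by positivity) hc
  have hcy : lam / 2 < c * |y| := (div_lt_iff₀ hy0).1 hc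
  have hs0 : Tendsto (fun N : ℕ => t / (N : ℝ)) atTop (nhds 0) :=
    tendsto_const_div_atTop_nhds_zero_nat t
  have hs2 : Tendsto (fun N : ℕ => t / (N : ℝ) / 2) atTop (nhds 0) := by
    simpa using hs0.div_const 2
  have hprod : Tendsto (fun N : ℕ => (c - t / (N : ℝ) / 2) * (|y| - t / (N : ℝ) / 2)) atTop
      (nhds (c * |y|)) := by
    simpa using (hs2.const_sub c).mul (hs2.const_sub |y|)
  have hbound : ∀ᶠ N : ℕ in atTop,
      |(μ {ω | 2 * (N : ℝ) * stsp1 lam y (A N ω) < t}).toReal - (1 - (1 - t / N) ^ N)| ≤ c ^ N := by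
    filter_upwards [eventually_ge_atTop 2, hs0.eventually_le_const one_pos,
      hs2.eventually_lt_const hc0, hs2.eventually_lt_const hy0,
      hprod.eventually_const_lt hcy] with N hN h1 h2 h3 h4
    have hN0 : (0 : ℝ) < N := by positivity
    have hX : Measurable (A N) := measurable_pi_lambda _ (hmeas N)
    have hmap := map_eq_restrict_cube (hmeas N) (hindep N) (hlaw N)
    have hset : {ω | 2 * (N : ℝ) * stsp1 lam y (A N ω) < t} =
        {ω | stsp1 lam y (A N ω) < t / N / 2} := by
      ext ω
      simp only [mem_ofPred_eq]
      rw [div_div, lt_div_iff₀ (by positivity)]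
      ring_nf
    rw [hset]
    exact abs_prob_stsp1_lt_sub_le hX hmap hN hlam (by positivity) h1 h2 h3 h4
  have hexp : Tendsto (fun N : ℕ => 1 - (1 - t / (N : ℝ)) ^ N) atTop (nhds (1 - Real.exp (-t))) := by
    refine Tendsto.const_sub 1 ?_
    simpa [sub_eq_add_neg, neg_div] using Real.tendsto_one_add_div_pow_exp (-t)
  have hdiff := (tendsto_zero_iff_abs_tendsto_zero _).2
    (squeeze_zero' (Eventually.of_forall fun _ => abs_nonneg _) hbound
      (tendsto_pow_atTop_nhds_zero_of_lt_one hc0.le hc1))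
  simpa using hdiff.add hexp
end
end

section
/- For each N ≥ 2 let A ∈ ℝ^N be a random vector with i.i.d. entries, each uniformly distributed on [0,1]. Then for every t > 0, lim_{N→∞} ℙ(δ(A) > t/N) = e^{−t}. -/
open MeasureTheory ProbabilityTheory Filter Real Set
open scoped ENNReal NNReal

noncomputable section

/-- `δ(A)`: the largest entry of `(|A₁|,…,|A_N|)` minus the second largest entry
(the second largest being `min_i max_{j ≠ i} |A_j|`). -/
def gap {N : ℕ} (A : Fin N → ℝ) : ℝ :=
  sSup (Set.range fun i => |A i|) -
    sInf (Set.range fun i : Fin N => sSup {v | ∃ j, j ≠ i ∧ v = |A j|})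

/-- A positive number `s` lies below the gap of `x` iff one entry exceeds all others by more
than `s` in absolute value. -/
theorem lt_gap_iff {n : ℕ} (x : Fin (n + 2) → ℝ) {s : ℝ} (hs : 0 < s) :
    s < gap x ↔ ∃ i, ∀ j, j ≠ i → |x j| + s < |x i| := by
  have hfin (i : Fin (n + 2)) : {v | ∃ j, j ≠ i ∧ v = |x j|}.Finite :=
    (Set.finite_range fun j => |x j|).subset (by rintro v ⟨j, -, rfl⟩; exact ⟨j, rfl⟩)
  have hne (i : Fin (n + 2)) : {v | ∃ j, j ≠ i ∧ v = |x j|}.Nonempty := by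
    obtain ⟨j, hj⟩ := exists_ne i
    exact ⟨_, j, hj, rfl⟩
  have hle (i j : Fin (n + 2)) (h : j ≠ i) : |x j| ≤ sSup {v | ∃ j, j ≠ i ∧ v = |x j|} :=
    le_csSup (hfin i).bddAbove ⟨j, h, rfl⟩
  unfold gap
  constructor
  · intro h
    obtain ⟨i, hi⟩ := (Set.range_nonempty fun i => |x i|).csSup_mem (Set.finite_range _)
    obtain ⟨k, hk⟩ := (Set.range_nonempty fun i : Fin (n + 2) =>
      sSup {v | ∃ j, j ≠ i ∧ v = |x j|}).csInf_mem (Set.finite_range _)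
    rw [← hi, ← hk] at h
    dsimp only at h
    obtain rfl : i = k := by
      by_contra hik
      linarith [hle k i hik]
    exact ⟨i, fun j hj => by linarith [hle i j hj]⟩
  · rintro ⟨i, hi⟩
    obtain ⟨j, hj, hjv⟩ := (hne i).csSup_mem (hfin i)
    have h₁ : |x i| ≤ sSup (Set.range fun i => |x i|) :=
      le_csSup (Set.finite_range _).bddAbove ⟨i, rfl⟩
    have h₂ : sInf (Set.range fun i : Fin (n + 2) => sSup {v | ∃ j, j ≠ i ∧ v = |x j|}) ≤
        sSup {v | ∃ j, j ≠ i ∧ v = |x j|} :=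
      csInf_le (Set.finite_range _).bddBelow ⟨i, rfl⟩
    linarith [hi j hj]

theorem measurableSet_forall_ne_abs_add_lt {n : ℕ} (i : Fin n) (s : ℝ) :
    MeasurableSet {x : Fin n → ℝ | ∀ j, j ≠ i → |x j| + s < |x i|} := by
  simp only [Set.ofPred_forall]
  refine .iInter fun j => .iInter fun _ => measurableSet_lt ?_ ?_ <;> fun_prop

theorem volume_restrict_abs_add_lt {s x : ℝ} (hs : 0 < s) (hx : x ∈ Set.Icc (0 : ℝ) 1) :
    volume.restrict (Set.Icc (0 : ℝ) 1) {y | |y| + s < |x|} = ENNReal.ofReal (x - s) := by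
  have h : {y : ℝ | |y| + s < |x|} ∩ Set.Icc 0 1 = Set.Ico 0 (x - s) := by
    ext y
    simp only [Set.mem_inter_iff, Set.mem_ofPred_eq, Set.mem_Icc, Set.mem_Ico, abs_of_nonneg hx.1]
    constructor
    · rintro ⟨h, h0, -⟩
      rw [abs_of_nonneg h0] at h
      exact ⟨h0, by linarith⟩
    · rintro ⟨h0, h⟩
      rw [abs_of_nonneg h0]
      exact ⟨by linarith, h0, by linarith [hx.2]⟩
  rw [Measure.restrict_apply' measurableSet_Icc, h, Real.volume_Ico, sub_zero]

theorem lintegral_ofReal_sub_pow {s : ℝ} (hs : 0 < s) (hs1 : s ≤ 1) (n : ℕ) :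
    ∫⁻ x in Set.Icc (0 : ℝ) 1, ENNReal.ofReal (x - s) ^ (n + 1) =
      ENNReal.ofReal ((1 - s) ^ (n + 2) / (n + 2)) := by
  have hsub : Set.Ioc s 1 ⊆ Set.Icc 0 1 := fun x hx => ⟨hs.le.trans hx.1.le, hx.2⟩
  have hzero : ∀ x ∈ Set.Icc (0 : ℝ) 1 \ Set.Ioc s 1,
      ENNReal.ofReal (x - s) ^ (n + 1) = 0 := by
    rintro x ⟨hx, hxs⟩
    have : x ≤ s := not_lt.1 fun h => hxs ⟨h, hx.2⟩
    rw [ENNReal.ofReal_of_nonpos (by linarith), zero_pow n.succ_ne_zero]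
  have hpow : ∀ x ∈ Set.Ioc s 1,
      ENNReal.ofReal (x - s) ^ (n + 1) = ENNReal.ofReal ((x - s) ^ (n + 1)) := fun x hx =>
    (ENNReal.ofReal_pow (by linarith [hx.1]) _).symm
  have hint : ∫ x in s..1, (x - s) ^ (n + 1) = (1 - s) ^ (n + 2) / (n + 2) := by
    rw [intervalIntegral.integral_comp_sub_right (fun x => x ^ (n + 1)), integral_pow]
    simp only [sub_self]
    push_cast
    ring
  rw [← lintegral_inter_add_sdiff _ _ (measurableSet_Ioc (a := s) (b := 1)),
    Set.inter_eq_right.2 hsub,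
    setLIntegral_eq_zero (measurableSet_Icc.diff measurableSet_Ioc) hzero, add_zero,
    setLIntegral_congr_fun measurableSet_Ioc hpow,
    ← ofReal_integral_eq_lintegral_ofReal, ← intervalIntegral.integral_of_le hs1, hint]
  · exact (Continuous.integrableOn_Icc (by fun_prop)).mono_set Set.Ioc_subset_Icc_self
  · filter_upwards [ae_restrict_mem measurableSet_Ioc] with x hx
    exact pow_nonneg (by linarith [hx.1]) _

theorem pi_forall_ne_abs_add_lt {n : ℕ} (i : Fin (n + 2)) {s : ℝ} (hs : 0 < s) (hs1 : s ≤ 1) :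
    Measure.pi (fun _ : Fin (n + 2) => volume.restrict (Set.Icc (0 : ℝ) 1))
      {x | ∀ j, j ≠ i → |x j| + s < |x i|} = ENNReal.ofReal ((1 - s) ^ (n + 2) / (n + 2)) := by
  set ν : Measure ℝ := volume.restrict (Set.Icc (0 : ℝ) 1) with hν
  have hset : {x : Fin (n + 2) → ℝ | ∀ j, j ≠ i → |x j| + s < |x i|} =
      MeasurableEquiv.piFinSuccAbove (fun _ => ℝ) i ⁻¹'
        {p | ∀ j, |p.2 j| + s < |p.1|} := by
    ext x
    simp only [Set.mem_ofPred_eq, Set.mem_preimage, MeasurableEquiv.piFinSuccAbove_apply,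
      Fin.insertNthEquiv_symm_apply, Fin.removeNth]
    exact ⟨fun h j => h _ (Fin.succAbove_ne i j), fun h j hj => by
      obtain ⟨k, rfl⟩ := Fin.exists_succAbove_eq hj
      exact h k⟩
  have hmeas : MeasurableSet {p : ℝ × (Fin (n + 1) → ℝ) | ∀ j, |p.2 j| + s < |p.1|} := by
    simp only [Set.ofPred_forall]
    refine .iInter fun j => measurableSet_lt ?_ ?_ <;> fun_prop
  rw [hset, (measurePreserving_piFinSuccAbove (fun _ => ν) i).measure_preimage_equiv,
    Measure.prod_apply hmeas, ← lintegral_ofReal_sub_pow hs hs1]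
  refine setLIntegral_congr_fun measurableSet_Icc fun x hx => ?_
  have hpi : Prod.mk x ⁻¹' {p : ℝ × (Fin (n + 1) → ℝ) | ∀ j, |p.2 j| + s < |p.1|} =
      Set.pi Set.univ fun _ => {y | |y| + s < |x|} := by
    ext y
    simp
  rw [hpi, Measure.pi_pi]
  simp [hν, volume_restrict_abs_add_lt hs hx]

/-- The gap of `n + 2` independent uniform variables exceeds `s` with probability
`(1 - s) ^ (n + 2)`. -/
theorem pi_lt_gap {n : ℕ} {s : ℝ} (hs : 0 < s) (hs1 : s ≤ 1) :
    Measure.pi (fun _ : Fin (n + 2) => volume.restrict (Set.Icc (0 : ℝ) 1)) {x | s < gap x} =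
      ENNReal.ofReal ((1 - s) ^ (n + 2)) := by
  have hset : {x : Fin (n + 2) → ℝ | s < gap x} =
      ⋃ i, {x | ∀ j, j ≠ i → |x j| + s < |x i|} := by
    ext x
    simp [lt_gap_iff x hs]
  have hdisj : Pairwise (Function.onFun Disjoint fun i : Fin (n + 2) =>
      {x : Fin (n + 2) → ℝ | ∀ j, j ≠ i → |x j| + s < |x i|}) := fun i k hik =>
    Set.disjoint_left.2 fun x hi hk => by linarith [hi k hik.symm, hk i hik]
  rw [hset, measure_iUnion hdisj fun i => measurableSet_forall_ne_abs_add_lt i s, tsum_fintype]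
  simp only [pi_forall_ne_abs_add_lt _ hs hs1, Finset.sum_const, Finset.card_univ,
    Fintype.card_fin]
  rw [← ENNReal.ofReal_nsmul, nsmul_eq_mul]
  congr 1
  push_cast
  field_simp

theorem measurableSet_lt_gap {n : ℕ} {s : ℝ} (hs : 0 < s) :
    MeasurableSet {x : Fin (n + 2) → ℝ | s < gap x} := by
  simp only [lt_gap_iff _ hs, Set.ofPred_exists]
  exact .iUnion fun i => measurableSet_forall_ne_abs_add_lt i s

/-- If `A ∈ ℝ^N` has i.i.d. entries uniformly distributed on `[0,1]`,
then for every `t > 0`, `lim_{N→∞} ℙ(δ(A) > t/N) = e^{−t}`. -/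
theorem gap_limit_uniform
    (Ω : Type) [MeasurableSpace Ω] (μ : Measure Ω) [IsProbabilityMeasure μ]
    (A : (N : ℕ) → Ω → Fin N → ℝ)
    (hmeas : ∀ N i, Measurable fun ω => A N ω i)
    (hindep : ∀ N, iIndepFun (fun i ω => A N ω i) μ)
    (hlaw : ∀ N i, Measure.map (fun ω => A N ω i) μ = volume.restrict (Set.Icc (0:ℝ) 1))
    (t : ℝ) (ht : 0 < t) :
    Tendsto (fun N : ℕ => (μ {ω | t / (N : ℝ) < gap (A N ω)}).toReal) atTop
      (nhds (Real.exp (-t))) := by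
  have hlim : Tendsto (fun N : ℕ => (1 - t / (N : ℝ)) ^ N) atTop (nhds (Real.exp (-t))) := by
    simpa [neg_div, sub_eq_add_neg] using Real.tendsto_one_add_div_pow_exp (-t)
  refine hlim.congr' ?_
  filter_upwards [eventually_ge_atTop 2, eventually_ge_atTop ⌈t⌉₊] with N hN2 hNt
  obtain ⟨n, rfl⟩ := Nat.exists_eq_add_of_le' hN2
  have hpos : (0 : ℝ) < (n + 2 : ℕ) := by positivity
  have hs : 0 < t / ((n + 2 : ℕ) : ℝ) := div_pos ht hpos
  have hs1 : t / ((n + 2 : ℕ) : ℝ) ≤ 1 := (div_le_one hpos).2 (Nat.ceil_le.1 hNt)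
  have hmap : μ.map (A (n + 2)) = Measure.pi fun _ => volume.restrict (Set.Icc (0 : ℝ) 1) := by
    have h := (iIndepFun_iff_map_fun_eq_pi_map fun i => (hmeas (n + 2) i).aemeasurable).1
      (hindep (n + 2))
    simpa only [hlaw] using h
  have hA : Measurable (A (n + 2)) := measurable_pi_lambda _ (hmeas (n + 2))
  have h := Measure.map_apply (μ := μ) hA (measurableSet_lt_gap hs)
  rw [hmap, pi_lt_gap hs hs1] at h
  rw [← ENNReal.toReal_ofReal (pow_nonneg (sub_nonneg.2 hs1) (n + 2)), h]
  rfl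
end
end
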